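/- There exists a universal constant c > 0 with the following property. For every dimension d ≥ 1, bandwidth σ > 0, and ε ∈ (0, 1/4], there exists M₀ > 0 such that for all M ≥ M₀ the following holds: if t ≥ 1 and h : ℝ^d → ℝ^t is any map with ‖h(x)‖ = 1 for every x ∈ ℝ^d and satisfying (1 − ε) ≤ D_K(x,y)/‖h(x) − h(y)‖ ≤ (1 + ε) for all distinct x, y in the closed ball of radius M·σ centered at the origin, then t ≥ c · ( d / (ε²·ln(1/ε)) ) · ln( M / ln(1/ε) ). -/

import Mathlib

/-- The Gaussian kernel distance `D_K(x,y) = √(2 - 2·exp(-‖x-y‖²/(2σ²)))`. -/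
noncomputable def DK (d : ℕ) (σ : ℝ) (x y : EuclideanSpace ℝ (Fin d)) : ℝ :=
  Real.sqrt (2 - 2 * Real.exp (-‖x - y‖ ^ 2 / (2 * σ ^ 2)))

/-- Welch bound, features form. -/
theorem welch_feat {ι κ : Type*} [Fintype ι] [Fintype κ] (φ : ι → κ → ℝ) :
    (∑ i, ∑ a, φ i a * φ i a) ^ 2 ≤ (Fintype.card κ : ℝ) *
      ∑ i, ∑ j, (∑ a, φ i a * φ j a) ^ 2 := by
  have h1 : (∑ i, ∑ a, φ i a * φ i a) = ∑ a, ∑ i, φ i a * φ i a := Finset.sum_comm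
  have h2 : ∑ i, ∑ j, (∑ a, φ i a * φ j a) ^ 2 = ∑ a, ∑ b, (∑ i, φ i a * φ i b) ^ 2 := by
    simp only [sq, Finset.sum_mul_sum]
    calc _ = ∑ i, ∑ a, ∑ j, ∑ b, φ i a * φ j a * (φ i b * φ j b) := by
            refine Finset.sum_congr rfl fun i _ => Finset.sum_comm
      _ = ∑ a, ∑ i, ∑ j, ∑ b, φ i a * φ j a * (φ i b * φ j b) := Finset.sum_comm
      _ = ∑ a, ∑ i, ∑ b, ∑ j, φ i a * φ j a * (φ i b * φ j b) := by
            refine Finset.sum_congr rfl fun a _ => Finset.sum_congr rfl fun i _ => Finset.sum_comm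
      _ = ∑ a, ∑ b, ∑ i, ∑ j, φ i a * φ j a * (φ i b * φ j b) := by
            refine Finset.sum_congr rfl fun a _ => Finset.sum_comm
      _ = _ := by
        refine Finset.sum_congr rfl fun a _ => Finset.sum_congr rfl fun b _ =>
          Finset.sum_congr rfl fun i _ => Finset.sum_congr rfl fun j _ => by ring
  rw [h1, h2]
  calc _ ≤ (Fintype.card κ : ℝ) * ∑ a, (∑ i, φ i a * φ i a) ^ 2 := by
        simpa using sq_sum_le_card_mul_sum_sq (s := (Finset.univ : Finset κ))
          (f := fun a => ∑ i, φ i a * φ i a)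
    _ ≤ _ := by
      gcongr with a
      exact Finset.single_le_sum (f := fun b => (∑ i, φ i a * φ i b) ^ 2)
        (fun b _ => sq_nonneg _) (Finset.mem_univ a)

theorem welch {ι : Type*} [Fintype ι] (t k : ℕ) (v : ι → Fin t → ℝ) :
    (∑ i, (∑ a, v i a * v i a) ^ k) ^ 2 ≤ ((t + k - 1).choose k : ℝ) *
      ∑ i, ∑ j, ((∑ a, v i a * v j a) ^ k) ^ 2 := by
  have key : ∀ x y : Fin t → ℝ, (∑ a, x a * y a) ^ k = ∑ s : Sym (Fin t) k,
      (Real.sqrt (s.1.countPerms : ℝ) * (s.1.map x).prod) *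
      (Real.sqrt (s.1.countPerms : ℝ) * (s.1.map y).prod) := by
    intro x y
    rw [Finset.sum_pow, Finset.sym_univ]
    refine Finset.sum_congr rfl fun s _ => ?_
    rw [Multiset.prod_map_mul, mul_mul_mul_comm, Real.mul_self_sqrt (by positivity)]
  have := welch_feat (ι := ι) (κ := Sym (Fin t) k) (fun i s =>
    (Real.sqrt (s.1.countPerms : ℝ) * (s.1.map (v i)).prod))
  rw [Sym.card_sym_eq_choose, Fintype.card_fin] at this
  simpa only [key] using this

theorem choose_bd (t k : ℕ) (hk : 1 ≤ k) :
    ((t + k - 1).choose k : ℝ) ≤ (Real.exp 1 * ((t + k) / k)) ^ k := by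
  have hk0 : (0:ℝ) < k := by exact_mod_cast hk
  have h1 := Nat.choose_le_pow_div (α := ℝ) k (t + k - 1)
  have h2 := Real.pow_div_factorial_le_exp (k:ℝ) hk0.le k
  have h3 : (((t + k - 1 : ℕ) : ℝ)) ≤ t + k := by exact_mod_cast Nat.sub_le _ _
  calc _ ≤ _ := h1
    _ ≤ ((t:ℝ) + k) ^ k / (k.factorial : ℝ) := by gcongr
    _ = (((t:ℝ) + k) / k) ^ k * ((k:ℝ) ^ k / (k.factorial : ℝ)) := by
      rw [div_pow]; field_simp
    _ ≤ (((t:ℝ) + k) / k) ^ k * Real.exp k := by gcongr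
    _ = _ := by rw [mul_pow, ← Real.exp_nat_mul, mul_one]; ring

/-- Alon's bound, in parametrized form. -/
theorem alon {ι : Type*} [Fintype ι] (t k : ℕ) (hk : 1 ≤ k) (η : ℝ) (hη : 0 < η) (hη' : η ≤ 1/5)
    (v : ι → EuclideanSpace ℝ (Fin t)) (hv : ∀ i, ‖v i‖ = 1)
    (hij : ∀ i j, i ≠ j → |inner ℝ (v i) (v j)| ≤ η)
    (hP : (1 / η ^ 2) ^ k ≤ (Fintype.card ι : ℝ)) : k * (1 / η ^ 2) / 8 ≤ (t : ℝ) := by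
  classical
  have hk0 : (0:ℝ) < k := by exact_mod_cast hk
  set N : ℝ := (Fintype.card ι : ℝ) with hN
  have hA : 25 ≤ 1 / η ^ 2 := by
    rw [le_div_iff₀ (by positivity)]; nlinarith
  set A := 1 / η ^ 2 with hAd
  have hA0 : 0 < A := by linarith
  have hN0 : 0 < N := lt_of_lt_of_le (by positivity) hP
  have hin : ∀ i j, inner ℝ (v i) (v j) = ∑ a, v i a * v j a := by
    intro i j
    simp [PiLp.inner_apply, mul_comm]
  have h1 : ∀ i, ∑ a, v i a * v i a = 1 := by
    intro i; rw [← hin, real_inner_self_eq_norm_sq, hv]; norm_num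
  have w := welch t k (fun i a => v i a)
  simp only [h1, ← hin, one_pow, Finset.sum_const, Finset.card_univ, nsmul_eq_mul, mul_one] at w
  rw [← hN] at w
  have hb : ∑ i, ∑ j, ((inner ℝ (v i) (v j)) ^ k) ^ 2 ≤ N + N ^ 2 * (1 / A ^ k) := by
    calc _ ≤ ∑ i : ι, ∑ j : ι, ((if i = j then 1 else 0) + 1 / A ^ k) := by
          gcongr with i _ j _
          by_cases h : i = j
          · subst h
            rw [hin, h1]; simp; positivity
          · simp only [h, if_false, zero_add]
            have : 1 / A ^ k = (η ^ k) ^ 2 := by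
              rw [hAd, one_div, one_div, inv_pow, inv_inv, ← pow_mul, ← pow_mul, mul_comm]
            rw [this, ← sq_abs, abs_pow]
            gcongr
            exact hij i j h
      _ = _ := by
        simp [Finset.sum_add_distrib]; ring
  have hC := choose_bd t k hk
  set C : ℝ := ((t + k - 1).choose k : ℝ)
  have hC0 : 0 ≤ C := by positivity
  have h2 : N ^ 2 ≤ C * (2 * (N ^ 2 * (1 / A ^ k))) := by
    refine w.trans (mul_le_mul_of_nonneg_left (hb.trans ?_) hC0)
    have : N ≤ N ^ 2 * (1 / A ^ k) := by
      rw [mul_one_div, le_div_iff₀ (by positivity)]; nlinarith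
    linarith
  have h3 : A ^ k ≤ 2 * C := by
    have hAk : 0 < A ^ k := by positivity
    have : N ^ 2 * A ^ k ≤ N ^ 2 * (2 * C) := by
      calc _ ≤ C * (2 * (N ^ 2 * (1 / A ^ k))) * A ^ k := by gcongr
        _ = _ := by field_simp
    exact le_of_mul_le_mul_left this (by positivity)
  have h4 : A ^ k ≤ (2 * (Real.exp 1 * ((t + k) / k))) ^ k := by
    rw [mul_pow]
    have : (2:ℝ) ≤ 2 ^ k := by
      simpa using pow_le_pow_right₀ (by norm_num : (1:ℝ) ≤ 2) hk
    calc _ ≤ 2 * C := h3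
      _ ≤ _ := by gcongr
  have h5 := le_of_pow_le_pow_left₀ (by omega) (by positivity) h4
  have he := Real.exp_one_lt_d9
  have h6 : A ≤ 5.5 * ((t + k) / k) := by
    refine h5.trans ?_
    have : (0:ℝ) ≤ (t + k) / k := by positivity
    nlinarith
  rw [← mul_div_assoc, le_div_iff₀ hk0] at h6
  nlinarith

theorem pack_five {ι : Type*} [Fintype ι] (t : ℕ) 
    (v : ι → EuclideanSpace ℝ (Fin t)) (hv : ∀ i, ‖v i‖ = 1)
    (hij : ∀ i j, i ≠ j → 1 / 2 ≤ ‖v i - v j‖) : Fintype.card ι ≤ 5 ^ t := by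
  classical
  have hs : ∀ i j, i ≠ j → 1 ≤ ‖(2:ℝ) • v i - (2:ℝ) • v j‖ := by
    intro i j h
    rw [← smul_sub, norm_smul]
    have := hij i j h
    norm_num; linarith
  have inj : Function.Injective fun i => (2:ℝ) • v i := by
    intro i j h
    by_contra hne
    have := hs i j hne
    simp only at h
    rw [h] at this; norm_num at this
  have := Besicovitch.card_le_of_separated (Finset.univ.image fun i => (2:ℝ) • v i)
    (by simp [norm_smul, hv])
    (by
      simp only [Finset.mem_image, Finset.mem_univ, true_and]
      rintro _ ⟨i, rfl⟩ _ ⟨j, rfl⟩ hne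
      exact hs i j (fun h => hne (by rw [h])))
  rw [Finset.card_image_of_injective _ inj] at this
  simpa using this

theorem pair_bd (d t : ℕ) (σ ε : ℝ) (hσ : 0 < σ) (hε : 0 < ε) (hε' : ε ≤ 1/4)
    (x y : EuclideanSpace ℝ (Fin d)) (u w : EuclideanSpace ℝ (Fin t)) (hu : ‖u‖ = 1) (hw : ‖w‖ = 1)
    (hxy : 2 / ε * σ ≤ ‖x - y‖)
    (h1 : 1 - ε ≤ Real.sqrt (2 - 2 * Real.exp (-‖x - y‖ ^ 2 / (2 * σ ^ 2))) / ‖u - w‖)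
    (h2 : Real.sqrt (2 - 2 * Real.exp (-‖x - y‖ ^ 2 / (2 * σ ^ 2))) / ‖u - w‖ ≤ 1 + ε) :
    1 / 2 ≤ ‖u - w‖ ∧ (ε ≤ 1/20 → |inner ℝ u w| ≤ 4 * ε) := by
  have hg : 0 < ‖u - w‖ := by
    rcases (norm_nonneg (u - w)).eq_or_lt with h | h
    · rw [← h, div_zero] at h1; linarith
    · exact h
  rw [le_div_iff₀ hg] at h1
  rw [div_le_iff₀ hg] at h2
  have hK : Real.exp (-‖x - y‖ ^ 2 / (2 * σ ^ 2)) ≤ ε ^ 2 / 2 := by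
    have hz : 2 / ε ^ 2 ≤ ‖x - y‖ ^ 2 / (2 * σ ^ 2) := by
      rw [le_div_iff₀ (by positivity)]
      calc _ = (2 / ε * σ) ^ 2 := by field_simp
        _ ≤ _ := by gcongr
    have hz' := Real.add_one_le_exp (‖x - y‖ ^ 2 / (2 * σ ^ 2))
    rw [neg_div, Real.exp_neg, inv_le_comm₀ (Real.exp_pos _) (by positivity), inv_div]
    linarith
  have hK0 := Real.exp_pos (-‖x - y‖ ^ 2 / (2 * σ ^ 2))
  set K := Real.exp (-‖x - y‖ ^ 2 / (2 * σ ^ 2))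
  have hD := Real.sq_sqrt (show 0 ≤ 2 - 2 * K by nlinarith)
  have hD0 := Real.sqrt_nonneg (2 - 2 * K)
  set D := Real.sqrt (2 - 2 * K)
  have hgi : ‖u - w‖ ^ 2 = 2 - 2 * inner ℝ u w := by
    rw [norm_sub_sq_real, hu, hw]; ring
  set g := ‖u - w‖
  have e1 : ((1 - ε) * g) ^ 2 ≤ D ^ 2 := by
    apply pow_le_pow_left₀ _ h1
    have : 0 ≤ 1 - ε := by linarith
    positivity
  have e2 : D ^ 2 ≤ ((1 + ε) * g) ^ 2 := pow_le_pow_left₀ hD0 h2 2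
  rw [mul_pow, hgi, hD] at e1 e2
  set I := inner ℝ u w
  constructor
  · by_contra! hlt
    have : g ^ 2 ≤ 1 / 4 := by nlinarith
    have h3 : (1 + ε) ^ 2 ≤ 25 / 16 := by nlinarith
    have : (1 + ε) ^ 2 * (2 - 2 * I) ≤ 25 / 16 * (1 / 4) := by
      rw [← hgi]; gcongr
    nlinarith
  · intro hs
    have hg2 : 0 ≤ 2 - 2 * I := by rw [← hgi]; positivity
    rw [abs_le]
    constructor
    · by_contra! hlt
      have : (1 - ε) ^ 2 * (1 + 4 * ε) < (1 - ε) ^ 2 * (1 - I) := by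
        have : 0 < 1 - ε := by linarith
        apply mul_lt_mul_of_pos_left _ (by positivity); linarith
      nlinarith [mul_pos hε hε, mul_pos (mul_pos hε hε) hε]
    · by_contra! hlt
      have : (1 + ε) ^ 2 * (1 - I) < (1 + ε) ^ 2 * (1 - 4 * ε) := by
        apply mul_lt_mul_of_pos_left _ (by positivity); linarith
      nlinarith [mul_pos hε hε, mul_pos (mul_pos hε hε) hε]

/-- Grid points. -/
theorem grid (d m : ℕ) (r : ℝ) (hr : 0 ≤ r) :
    ∃ p : (Fin d → Fin m) → EuclideanSpace ℝ (Fin d),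
      (∀ i, ‖p i‖ ≤ r * m * d) ∧ ∀ i j, i ≠ j → r ≤ ‖p i - p j‖ := by
  refine ⟨fun i => WithLp.toLp 2 fun a => r * ((i a : ℕ) : ℝ), ?_, ?_⟩
  · intro i
    rw [EuclideanSpace.norm_eq]
    apply Real.sqrt_le_iff.2 ⟨by positivity, ?_⟩
    calc _ ≤ ∑ a : Fin d, (r * m) ^ 2 := by
          gcongr with a
          simp only [Real.norm_eq_abs]
          rw [abs_of_nonneg (by positivity)]
          gcongr
          exact (i a).2.le
      _ = (r * m) ^ 2 * d := by simp; ring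
      _ ≤ (r * m) ^ 2 * d ^ 2 := by
        gcongr
        exact_mod_cast Nat.le_self_pow (by norm_num) d
      _ = _ := by ring
  · intro i j hij
    obtain ⟨a, ha⟩ := Function.ne_iff.1 hij
    refine le_trans ?_ (PiLp.norm_apply_le _ a)
    simp only [PiLp.sub_apply, Real.norm_eq_abs]
    rw [← mul_sub, abs_mul, abs_of_nonneg hr]
    have hne : ((i a : ℕ) : ℤ) - ((j a : ℕ) : ℤ) ≠ 0 := by
      intro h; apply ha; apply Fin.ext; omega
    have h1 : (1:ℝ) ≤ |((i a : ℕ) : ℝ) - ((j a : ℕ) : ℝ)| := by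
      have := Int.one_le_abs hne
      exact_mod_cast this
    nlinarith

set_option maxHeartbeats 1000000 in
theorem kernel_distance_dimension_lower_bound :
    ∃ c : ℝ, 0 < c ∧
      ∀ (d : ℕ) (σ ε : ℝ), 1 ≤ d → 0 < σ → 0 < ε → ε ≤ 1/4 →
        ∃ M₀ : ℝ, 0 < M₀ ∧
          ∀ M : ℝ, M₀ ≤ M →
            ∀ (t : ℕ), 1 ≤ t →
              ∀ h : EuclideanSpace ℝ (Fin d) → EuclideanSpace ℝ (Fin t),
                (∀ x : EuclideanSpace ℝ (Fin d), ‖h x‖ = 1) →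
                (∀ x y : EuclideanSpace ℝ (Fin d),
                    ‖x‖ ≤ M * σ → ‖y‖ ≤ M * σ → x ≠ y →
                    1 - ε ≤ DK d σ x y / ‖h x - h y‖ ∧
                    DK d σ x y / ‖h x - h y‖ ≤ 1 + ε) →
                c * ((d : ℝ) / (ε ^ 2 * Real.log (1 / ε))) *
                    Real.log (M / Real.log (1 / ε)) ≤ (t : ℝ) := by
  refine ⟨1 / 2000, by norm_num, ?_⟩
  intro d σ ε hd hσ hε hε'
  have hd1 : (1:ℝ) ≤ d := by exact_mod_cast hd
  set B : ℝ := 4 * d / ε with hB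
  have hB1 : 1 ≤ B := by rw [hB, le_div_iff₀ hε]; linarith
  refine ⟨B ^ 3, by positivity, ?_⟩
  intro M hM t _ht h hn hh
  have hM0 : 0 < M := lt_of_lt_of_le (by positivity) hM
  set q : ℝ := M / B with hq
  have hq2 : B ^ 2 ≤ q := by
    rw [hq, le_div_iff₀ (by positivity)]; nlinarith
  have hMq : M = q * B := by rw [hq]; field_simp
  have hBq : B ≤ q := by nlinarith
  set m : ℕ := ⌊2 * q⌋₊ with hm
  have hm1 : (m : ℝ) ≤ 2 * q := Nat.floor_le (by linarith)
  have hm2 : q ≤ m := by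
    have := Nat.lt_floor_add_one (2 * q)
    rw [← hm] at this
    linarith
  have hm0 : (1:ℝ) ≤ m := by linarith
  have hMm : M ≤ (m:ℝ) ^ 2 := by rw [hMq]; nlinarith
  have hL1 : 1 ≤ Real.log (1 / ε) := by
    rw [Real.le_log_iff_exp_le (by positivity)]
    have := Real.exp_one_lt_d9
    have h4 : 4 ≤ 1 / ε := by rw [le_div_iff₀ hε]; linarith
    linarith
  set L := Real.log (1 / ε) with hL
  have hlogM : Real.log (M / L) ≤ 2 * Real.log m := by
    calc _ ≤ Real.log ((m:ℝ) ^ 2) := by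
          apply Real.log_le_log (by positivity)
          exact (div_le_self hM0.le hL1).trans hMm
      _ = _ := by rw [Real.log_pow]; norm_num
  have hlogm : 0 ≤ Real.log m := Real.log_nonneg hm0
  obtain ⟨p, hp1, hp2⟩ := grid d m (2 / ε * σ) (by positivity)
  have hpM : ∀ i, ‖p i‖ ≤ M * σ := by
    intro i
    refine (hp1 i).trans ?_
    calc _ ≤ 2 / ε * σ * (2 * q) * d := by gcongr
      _ = M * σ := by rw [hMq, hB]; field_simp; ring
  have hpair : ∀ i j, i ≠ j → 1 / 2 ≤ ‖h (p i) - h (p j)‖ ∧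
      (ε ≤ 1/20 → |inner ℝ (h (p i)) (h (p j))| ≤ 4 * ε) := by
    intro i j hij
    have hr : 0 < 2 / ε * σ := by positivity
    have hne : p i ≠ p j := by
      intro he
      have := hp2 i j hij
      rw [he, sub_self, norm_zero] at this
      linarith
    obtain ⟨a1, a2⟩ := hh (p i) (p j) (hpM i) (hpM j) hne
    exact pair_bd d t σ ε hσ hε hε' (p i) (p j) _ _ (hn _) (hn _) (hp2 i j hij) a1 a2
  have hcard : (Fintype.card (Fin d → Fin m) : ℝ) = (m:ℝ) ^ d := by simp
  have main : (1 / 1000) * (d * Real.log m) / (ε ^ 2 * L) ≤ t := by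
    have hεL : 0 < ε ^ 2 * L := by positivity
    rcases le_total ε (1/20) with hs | hs
    · set A : ℝ := 1 / (4 * ε) ^ 2 with hA
      have hA25 : 25 ≤ A := by
        rw [hA, le_div_iff₀ (by positivity)]; nlinarith
      have hlA0 : 0 < Real.log A := Real.log_pos (by linarith)
      have hAm : A ≤ m := by
        refine le_trans ?_ (hq2.trans hm2)
        rw [hA, hB, div_pow, mul_pow, mul_pow, div_le_div_iff₀ (by positivity) (by positivity)]
        have : 0 < ε ^ 2 := by positivity
        have : 1 ≤ (d:ℝ) ^ 2 := by nlinarith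
        have : 0 < ε ^ 2 := by positivity
        nlinarith
      have hlA : Real.log A ≤ 2 * L := by
        have : A ≤ (1 / ε) ^ 2 := by
          rw [hA, div_pow, one_pow]
          apply one_div_le_one_div_of_le (by positivity)
          gcongr; linarith
        calc _ ≤ Real.log ((1 / ε) ^ 2) := Real.log_le_log (by linarith) this
          _ = _ := by rw [Real.log_pow]; norm_num [hL]
      set x := d * Real.log m / Real.log A with hx
      have hx1 : 1 ≤ x := by
        rw [hx, le_div_iff₀ hlA0]
        have := Real.log_le_log (by linarith) hAm
        nlinarith
      set k := ⌊x⌋₊ with hk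
      have hk1 : 1 ≤ k := Nat.one_le_floor_iff x |>.2 hx1
      have hkx : (k:ℝ) ≤ x := Nat.floor_le (by linarith)
      have hkx2 : x / 2 ≤ k := by
        have := Nat.lt_floor_add_one x
        rw [← hk] at this
        have : (1:ℝ) ≤ k := by exact_mod_cast hk1
        linarith
      have hP : A ^ k ≤ (Fintype.card (Fin d → Fin m) : ℝ) := by
        rw [hcard, ← Real.log_le_log_iff (by positivity) (by positivity), Real.log_pow,
          Real.log_pow]
        rw [hx, le_div_iff₀ hlA0] at hkx
        exact hkx
      have := alon t k hk1 (4 * ε) (by positivity) (by linarith) (fun i => h (p i))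
        (fun i => hn _) (fun i j hij => (hpair i j hij).2 hs) hP
      refine le_trans ?_ this
      calc _ ≤ (1 / 512) * (d * Real.log m) / (ε ^ 2 * L) := by gcongr; norm_num
        _ = (d * Real.log m / (2 * L)) / 2 * (1 / (4 * ε) ^ 2) / 8 := by field_simp; ring
        _ ≤ (d * Real.log m / Real.log A) / 2 * (1 / (4 * ε) ^ 2) / 8 := by gcongr
        _ ≤ _ := by gcongr
    · have h5 := pack_five t (fun i => h (p i)) (fun i => hn _) (fun i j hij => (hpair i j hij).1)
      have h5' : (m:ℝ) ^ d ≤ 5 ^ t := by rw [← hcard]; exact_mod_cast h5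
      have h6 := Real.log_le_log (by positivity) h5'
      rw [Real.log_pow, Real.log_pow] at h6
      have hl5 : Real.log 5 ≤ 2 := by
        rw [Real.log_le_iff_le_exp (by norm_num)]
        have e : Real.exp 2 = Real.exp 1 * Real.exp 1 := by rw [← Real.exp_add]; norm_num
        have := Real.exp_one_gt_d9
        rw [e]; nlinarith
      have ht0 : (0:ℝ) ≤ t := by positivity
      have h7 : d * Real.log m ≤ 2 * t := by
        have := mul_le_mul_of_nonneg_left hl5 ht0
        linarith
      have h8 : 1 / 400 ≤ ε ^ 2 * L := by
        have : 1 / 400 ≤ ε ^ 2 := by nlinarith only [hs]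
        nlinarith only [this, hL1]
      rw [div_le_iff₀ hεL]
      have h9 := mul_le_mul_of_nonneg_left h8 ht0
      linarith
  refine le_trans ?_ main
  calc _ ≤ 1 / 2000 * (d / (ε ^ 2 * L)) * (2 * Real.log m) := by gcongr
    _ = _ := by field_simp; ring
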